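/- arXiv:1905.05527 — 5 statements merged into one kernel-verified Lean document; each statement's English description precedes it below -/
import Mathlib

section
/- Fix a real number c and an integer r ≥ 1. The map φ_LCR : D → ℝ defined by φ_LCR(f) = sup_{t∈[0,1]} { f(t) − c t − J_r^t(f) } is Lipschitz continuous with respect to the Skorokhod J1 metric with Lipschitz constant at most 1 + |c| + 2r: for all càdlàg f, g : [0,1] → ℝ, |φ_LCR(f) − φ_LCR(g)| ≤ (1 + |c| + 2r)·d(f,g). -/
open MeasureTheory Filter Set Polynomial

noncomputable section

/-- Jump of `f` at `s`, with the convention `f(0⁻) = f(0)` (so the jump at `0` is `0`). -/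
def jumpAt (f : ℝ → ℝ) (s : ℝ) : ℝ :=
  if s = 0 then 0 else f s - Function.leftLim f s

/-- `J m t f`: supremum over `m`-tuples of pairwise distinct points of `[0,t]` of the
sum of the jumps of `f` at these points (`J m 0 f = 0`). -/
def J (m : ℕ) (t : ℝ) (f : ℝ → ℝ) : ℝ :=
  ⨆ s : { s : Fin m → ℝ // (∀ i, s i ∈ Set.Icc 0 t) ∧ Function.Injective s },
    ∑ i, jumpAt f (s.val i)

/-- `f` is càdlàg on `[0,1]`: right-continuous, with left limits. -/
def Cadlag (f : ℝ → ℝ) : Prop :=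
  (∀ x ∈ Set.Icc (0:ℝ) 1, ContinuousWithinAt f (Set.Ici x) x) ∧
  (∀ x ∈ Set.Ioc (0:ℝ) 1, ∃ l, Filter.Tendsto f (nhdsWithin x (Set.Iio x)) (nhds l))

/-- A strictly increasing continuous bijection of `[0,1]` onto itself. -/
def TimeChange (l : ℝ → ℝ) : Prop :=
  StrictMonoOn l (Set.Icc 0 1) ∧ ContinuousOn l (Set.Icc 0 1) ∧
    Set.BijOn l (Set.Icc 0 1) (Set.Icc 0 1)

/-- Uniform (sup) norm on `[0,1]`. -/
def supIcc (f : ℝ → ℝ) : ℝ := ⨆ x : Set.Icc (0:ℝ) 1, |f x.val|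

/-- The Skorokhod J1 metric on càdlàg functions on `[0,1]`. -/
def skorokhodDist (f g : ℝ → ℝ) : ℝ :=
  ⨅ l : { l : ℝ → ℝ // TimeChange l },
    max (supIcc fun x => l.val x - x) (supIcc fun x => f x - g (l.val x))

/-- The LCR functional `φ_LCR(f) = sup_{t∈[0,1]} { f(t) − c t − J_r^t(f) }`. -/
def phiLCR (c : ℝ) (r : ℕ) (f : ℝ → ℝ) : ℝ :=
  ⨆ t : Set.Icc (0:ℝ) 1, (f t.val - c * t.val - J r t.val f)

/-- The ECOMOR functional
`φ_EC(f) = sup_{t∈[0,1]} { f(t) − c t − (r+1)·J_r^t(f) + r·J_{r+1}^t(f) }`. -/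
def phiEC (c : ℝ) (r : ℕ) (f : ℝ → ℝ) : ℝ :=
  ⨆ t : Set.Icc (0:ℝ) 1,
    (f t.val - c * t.val - ((r:ℝ) + 1) * J r t.val f + (r:ℝ) * J (r+1) t.val f)

/-- The step function `x ↦ ∑ i, y i · 1_{[τ i, 1]}(x)`, viewed as a function on `ℝ`. -/
def stepFun {k : ℕ} (y τ : Fin k → ℝ) : ℝ → ℝ :=
  fun x => ∑ i, if τ i ≤ x then y i else 0

/-- Nondecreasing step functions vanishing at the origin with at most `j` steps. -/
def stepSet (j : ℕ) : Set (ℝ → ℝ) :=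
  { f | ∃ k : ℕ, k ≤ j ∧ ∃ y τ : Fin k → ℝ,
      (∀ i, 0 < y i) ∧ (∀ i, τ i ∈ Set.Ioo (0:ℝ) 1) ∧ Function.Injective τ ∧
      f = stepFun y τ }

/-- Skorokhod distance from a function to a set of functions. -/
def distToSet (f : ℝ → ℝ) (A : Set (ℝ → ℝ)) : ℝ := ⨅ g : A, skorokhodDist f g.val

/-- The Gauss hypergeometric function `₂F₁(b,e;d;z)`. -/
def hyp2F1 (b e d z : ℝ) : ℝ :=
  ∑' k : ℕ, ((ascPochhammer ℝ k).eval b * (ascPochhammer ℝ k).eval e /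
    (ascPochhammer ℝ k).eval d) * z ^ k / (k.factorial : ℝ)

end

/-- A surjective reindexing that moves values by at most `δ` moves the supremum by at most `δ`. -/
lemma abs_iSup_sub_iSup_le {α β : Type*} {F : α → ℝ} {G : β → ℝ} {e : α → β}
    (he : Function.Surjective e) {δ : ℝ} (hδ : 0 ≤ δ) (h : ∀ a, |F a - G (e a)| ≤ δ) :
    |(⨆ a, F a) - ⨆ b, G b| ≤ δ := by
  rcases isEmpty_or_nonempty α with hα | hα
  · have : IsEmpty β := ⟨fun b => hα.elim (he b).choose⟩
    simpa [Real.iSup_of_isEmpty] using hδ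
  rw [← he.iSup_comp]
  by_cases hF : BddAbove (range F)
  · obtain ⟨M, hM⟩ := hF
    have hG : BddAbove (range fun a => G (e a)) := by
      refine ⟨M + δ, ?_⟩
      rintro _ ⟨a, rfl⟩
      have := hM ⟨a, rfl⟩
      have := abs_le.1 (h a)
      dsimp only
      linarith
    rw [abs_sub_le_iff, sub_le_iff_le_add, sub_le_iff_le_add]
    refine ⟨ciSup_le fun a => ?_, ciSup_le fun a => ?_⟩
    · have := le_ciSup hG a
      have := abs_le.1 (h a)
      linarith
    · have := le_ciSup ⟨M, hM⟩ a
      have := abs_le.1 (h a)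
      linarith
  · have hG : ¬ BddAbove (range fun a => G (e a)) := by
      rintro ⟨M, hM⟩
      refine hF ⟨M + δ, ?_⟩
      rintro _ ⟨a, rfl⟩
      have := hM ⟨a, rfl⟩
      have := abs_le.1 (h a)
      dsimp only at *
      linarith
    rw [Real.iSup_of_not_bddAbove hF, Real.iSup_of_not_bddAbove hG]
    simpa using hδ

lemma Cadlag.exists_abs_le {f : ℝ → ℝ} (hf : Cadlag f) :
    ∃ M, ∀ x ∈ Icc (0 : ℝ) 1, |f x| ≤ M := by
  refine isCompact_Icc.induction_on (p := fun s => ∃ M, ∀ x ∈ s, |f x| ≤ M) ⟨0, by simp⟩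
    (fun s t hst ⟨M, hM⟩ => ⟨M, fun x hx => hM x (hst hx)⟩) ?_ ?_
  · rintro s t ⟨M, hM⟩ ⟨N, hN⟩
    refine ⟨max M N, fun x hx => ?_⟩
    rcases hx with hx | hx
    · exact (hM x hx).trans (le_max_left _ _)
    · exact (hN x hx).trans (le_max_right _ _)
  · intro x hx
    have hr : {y | |f y| ≤ |f x| + 1} ∈ nhdsWithin x (Ici x) :=
      (hf.1 x hx).abs.eventually_le_const (lt_add_one _)
    rcases hx.1.eq_or_lt with rfl | h0
    · exact ⟨_, nhdsWithin_mono _ Icc_subset_Ici_self hr, _, fun y hy => hy⟩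
    · obtain ⟨l, hl⟩ := hf.2 x ⟨h0, hx.2⟩
      have hl' : {y | |f y| ≤ |l| + 1} ∈ nhdsWithin x (Iio x) :=
        hl.abs.eventually_le_const (lt_add_one _)
      refine ⟨{y | |f y| ≤ max (|l| + 1) (|f x| + 1)}, mem_nhdsWithin_of_mem_nhds ?_, _,
        fun y hy => hy⟩
      rw [← nhdsLT_sup_nhdsGE]
      refine mem_sup.2 ⟨?_, ?_⟩
      · filter_upwards [hl'] with y hy using le_max_of_le_left hy
      · filter_upwards [hr] with y hy using le_max_of_le_right hy

lemma Cadlag.tendsto_leftLim {f : ℝ → ℝ} (hf : Cadlag f) {x : ℝ} (hx : x ∈ Ioc (0 : ℝ) 1) :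
    Tendsto f (nhdsWithin x (Iio x)) (nhds (Function.leftLim f x)) :=
  tendsto_leftLim_of_tendsto (hf.2 x hx)

namespace TimeChange

variable {l : ℝ → ℝ}

lemma map_zero (hl : TimeChange l) : l 0 = 0 := by
  obtain ⟨x, hx, hx0⟩ := hl.2.2.surjOn (left_mem_Icc.2 zero_le_one)
  have h0 : (0 : ℝ) ∈ Icc (0 : ℝ) 1 := left_mem_Icc.2 zero_le_one
  exact le_antisymm (hx0 ▸ hl.1.monotoneOn h0 hx hx.1) (hl.2.2.mapsTo h0).1

lemma map_pos (hl : TimeChange l) {x : ℝ} (hx : x ∈ Ioc (0 : ℝ) 1) : 0 < l x :=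
  hl.map_zero ▸ hl.1 (left_mem_Icc.2 zero_le_one) (Ioc_subset_Icc_self hx) hx.1

lemma tendsto_nhdsLT (hl : TimeChange l) {x : ℝ} (hx : x ∈ Ioc (0 : ℝ) 1) :
    Tendsto l (nhdsWithin x (Iio x)) (nhdsWithin (l x) (Iio (l x))) := by
  have hsub : Ioo 0 x ⊆ Icc (0 : ℝ) 1 := fun y hy => ⟨hy.1.le, hy.2.le.trans hx.2⟩
  rw [← nhdsWithin_Ioo_eq_nhdsLT hx.1]
  refine tendsto_nhdsWithin_iff.2
    ⟨(hl.2.1 x (Ioc_subset_Icc_self hx)).mono_left (nhdsWithin_mono _ hsub), ?_⟩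
  filter_upwards [self_mem_nhdsWithin] with y hy
  exact hl.1 (hsub hy) (Ioc_subset_Icc_self hx) hy.2

lemma abs_jumpAt_sub_le (hl : TimeChange l) {f g : ℝ → ℝ} (hf : Cadlag f) (hg : Cadlag g)
    {ε : ℝ} (hfg : ∀ x ∈ Icc (0 : ℝ) 1, |f x - g (l x)| ≤ ε) {s : ℝ}
    (hs : s ∈ Icc (0 : ℝ) 1) : |jumpAt f s - jumpAt g (l s)| ≤ 2 * ε := by
  have hs1 := hfg s hs
  rcases hs.1.eq_or_lt with rfl | h0
  · have := (abs_nonneg _).trans hs1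
    simpa [jumpAt, hl.map_zero] using this
  have hs' : s ∈ Ioc (0 : ℝ) 1 := ⟨h0, hs.2⟩
  have hlim : |Function.leftLim f s - Function.leftLim g (l s)| ≤ ε := by
    refine le_of_tendsto ((hf.tendsto_leftLim hs').sub ((hg.tendsto_leftLim
      ⟨hl.map_pos hs', (hl.2.2.mapsTo hs).2⟩).comp (hl.tendsto_nhdsLT hs'))).abs ?_
    filter_upwards [Ioo_mem_nhdsLT h0] with y hy
    exact hfg y ⟨hy.1.le, hy.2.le.trans hs.2⟩
  rw [jumpAt, jumpAt, if_neg h0.ne', if_neg (hl.map_pos hs').ne']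
  rw [abs_le] at *
  constructor <;> linarith

lemma abs_J_sub_le (hl : TimeChange l) {f g : ℝ → ℝ} (hf : Cadlag f) (hg : Cadlag g)
    {ε : ℝ} (hfg : ∀ x ∈ Icc (0 : ℝ) 1, |f x - g (l x)| ≤ ε) (m : ℕ) {t : ℝ}
    (ht : t ∈ Icc (0 : ℝ) 1) : |J m t f - J m (l t) g| ≤ 2 * (m : ℝ) * ε := by
  have hε : 0 ≤ ε := (abs_nonneg _).trans (hfg t ht)
  have hsub : Icc 0 t ⊆ Icc (0 : ℝ) 1 := Icc_subset_Icc_right ht.2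
  let e : { s : Fin m → ℝ // (∀ i, s i ∈ Icc 0 t) ∧ Function.Injective s } →
      { s : Fin m → ℝ // (∀ i, s i ∈ Icc 0 (l t)) ∧ Function.Injective s } := fun s =>
    ⟨fun i => l (s.1 i), fun i => ⟨(hl.2.2.mapsTo (hsub (s.2.1 i))).1,
      hl.1.monotoneOn (hsub (s.2.1 i)) ht (s.2.1 i).2⟩,
      fun i j hij => s.2.2 (hl.2.2.injOn (hsub (s.2.1 i)) (hsub (s.2.1 j)) hij)⟩
  have he : Function.Surjective e := by
    rintro ⟨u, hu, hinj⟩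
    have hlt := (hl.2.2.mapsTo ht).2
    choose s hs hsu using fun i => hl.2.2.surjOn ⟨(hu i).1, (hu i).2.trans hlt⟩
    refine ⟨⟨s, fun i => ⟨(hs i).1, (hl.1.le_iff_le (hs i) ht).1 ?_⟩, fun i j hij => hinj ?_⟩, ?_⟩
    · rw [hsu]
      exact (hu i).2
    · rw [← hsu, ← hsu, hij]
    · exact Subtype.ext (funext hsu)
  refine abs_iSup_sub_iSup_le he (by positivity) fun s => ?_
  rw [← Finset.sum_sub_distrib]
  calc |∑ i, (jumpAt f (s.1 i) - jumpAt g (l (s.1 i)))|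
      ≤ ∑ i, |jumpAt f (s.1 i) - jumpAt g (l (s.1 i))| := Finset.abs_sum_le_sum_abs _ _
    _ ≤ ∑ _i : Fin m, 2 * ε :=
        Finset.sum_le_sum fun i _ => hl.abs_jumpAt_sub_le hf hg hfg (hsub (s.2.1 i))
    _ = 2 * (m : ℝ) * ε := by
        simp
        ring

lemma abs_phiLCR_sub_le (hl : TimeChange l) {f g : ℝ → ℝ} (hf : Cadlag f) (hg : Cadlag g)
    {ε : ℝ} (hlε : ∀ x ∈ Icc (0 : ℝ) 1, |l x - x| ≤ ε)
    (hfg : ∀ x ∈ Icc (0 : ℝ) 1, |f x - g (l x)| ≤ ε) (c : ℝ) (r : ℕ) :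
    |phiLCR c r f - phiLCR c r g| ≤ (1 + |c| + 2 * (r : ℝ)) * ε := by
  have hε : 0 ≤ ε := (abs_nonneg _).trans (hlε 0 (left_mem_Icc.2 zero_le_one))
  have he : Function.Surjective (hl.2.2.mapsTo.restrict l (Icc 0 1) (Icc 0 1)) :=
    (MapsTo.restrict_surjective_iff _).2 hl.2.2.surjOn
  refine abs_iSup_sub_iSup_le he (by positivity) fun t => ?_
  change |f t - c * t - J r t f - (g (l t) - c * l t - J r (l t) g)| ≤ _
  have h1 := abs_le.1 (hfg t t.2)
  have h2 : |c * (l t - t)| ≤ |c| * ε := by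
    rw [abs_mul]
    exact mul_le_mul_of_nonneg_left (hlε t t.2) (abs_nonneg c)
  have h3 := abs_le.1 (hl.abs_J_sub_le hf hg hfg r t.2)
  rw [abs_le] at h2 ⊢
  constructor <;> linarith

end TimeChange

lemma abs_le_supIcc {f : ℝ → ℝ} {M : ℝ} (hM : ∀ x ∈ Icc (0 : ℝ) 1, |f x| ≤ M) {x : ℝ}
    (hx : x ∈ Icc (0 : ℝ) 1) : |f x| ≤ supIcc f :=
  le_ciSup (f := fun y : Icc (0 : ℝ) 1 => |f y|)
    ⟨M, by rintro _ ⟨y, rfl⟩; exact hM y y.2⟩ ⟨x, hx⟩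

/-- the LCR functional is Lipschitz with constant at most `1 + |c| + 2r`
w.r.t. the Skorokhod J1 metric. -/
theorem phiLCR_lipschitz (c : ℝ) (r : ℕ) (hr : 1 ≤ r)
    (f g : ℝ → ℝ) (hf : Cadlag f) (hg : Cadlag g) :
    |phiLCR c r f - phiLCR c r g| ≤ (1 + |c| + 2 * (r : ℝ)) * skorokhodDist f g := by
  have : Nonempty { l : ℝ → ℝ // TimeChange l } :=
    ⟨id, strictMonoOn_id, continuousOn_id, bijOn_id _⟩
  rw [skorokhodDist, Real.mul_iInf_of_nonneg (by positivity)]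
  refine le_ciInf fun ⟨l, hl⟩ => ?_
  obtain ⟨M, hM⟩ := hf.exists_abs_le
  obtain ⟨N, hN⟩ := hg.exists_abs_le
  refine hl.abs_phiLCR_sub_le hf hg (fun x hx => le_max_of_le_left ?_)
    (fun x hx => le_max_of_le_right ?_) c r
  · refine abs_le_supIcc (f := fun x => l x - x) (M := 1) (fun y hy => ?_) hx
    have := hl.2.2.mapsTo hy
    rw [abs_le]
    constructor <;> linarith [this.1, this.2, hy.1, hy.2]
  · refine abs_le_supIcc (f := fun x => f x - g (l x)) (M := M + N) (fun y hy => ?_) hx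
    exact (abs_sub _ _).trans (add_le_add (hM y hy) (hN _ (hl.2.2.mapsTo hy)))
end

section
/- Fix a real number c and an integer r ≥ 1, and let f : [0,1] → ℝ be a nondecreasing step function vanishing at the origin with at most r steps, i.e. f = Σ_{i=1}^k y_i·1_{[t_i,1]} with 0 ≤ k ≤ r, y_1,…,y_k > 0, and t_1,…,t_k ∈ (0,1) pairwise distinct. Then φ_EC(f) = sup_{t∈[0,1]} { f(t) − c t − (r+1)·J_r^t(f) + r·J_{r+1}^t(f) } = c_−, where c_− = max(0,−c). -/
open MeasureTheory Filter Set Polynomial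

theorem leftLim_stepFun {k : ℕ} (y τ : Fin k → ℝ) (s : ℝ) :
    Function.leftLim (stepFun y τ) s = ∑ i, if τ i < s then y i else 0 := by
  apply leftLim_eq_of_tendsto
  refine tendsto_finsetSum _ fun i _ => ?_
  refine tendsto_const_nhds.congr' ?_
  by_cases h : τ i < s
  · filter_upwards [Ioo_mem_nhdsLT h] with x hx
    rw [if_pos h, if_pos hx.1.le]
  · filter_upwards [self_mem_nhdsWithin] with x hx
    rw [if_neg h, if_neg fun h' => h (h'.trans_lt hx)]

theorem jumpAt_stepFun {k : ℕ} (y τ : Fin k → ℝ) (hτ : ∀ i, 0 < τ i) (s : ℝ) :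
    jumpAt (stepFun y τ) s = ∑ i, if τ i = s then y i else 0 := by
  unfold jumpAt
  split_ifs with hs
  · subst hs
    exact (Finset.sum_eq_zero fun i _ => if_neg (hτ i).ne').symm
  · rw [leftLim_stepFun, stepFun, ← Finset.sum_sub_distrib]
    refine Finset.sum_congr rfl fun i _ => ?_
    rcases lt_trichotomy (τ i) s with h | h | h
    · simp [h, h.le, h.ne]
    · simp [h]
    · simp [h.not_ge, h.not_gt, h.ne']

theorem sum_jumpAt_stepFun_le {k : ℕ} (y τ : Fin k → ℝ) (hy : ∀ i, 0 ≤ y i)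
    (hτ : ∀ i, 0 < τ i) {m : ℕ} {t : ℝ} {s : Fin m → ℝ} (hs : ∀ j, s j ∈ Set.Icc 0 t)
    (hinj : Function.Injective s) :
    ∑ j, jumpAt (stepFun y τ) (s j) ≤ stepFun y τ t := by
  simp_rw [jumpAt_stepFun y τ hτ]
  rw [Finset.sum_comm]
  refine Finset.sum_le_sum fun i _ => ?_
  by_cases h : ∃ j, s j = τ i
  · obtain ⟨j, hj⟩ := h
    rw [if_pos (hj ▸ (hs j).2), Finset.sum_eq_single j]
    · simp [hj]
    · intro b _ hb
      exact if_neg fun h => hb (hinj (h.symm.trans hj.symm))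
    · simp
  · rw [Finset.sum_eq_zero fun j _ => if_neg fun h' => h ⟨j, h'.symm⟩]
    split_ifs
    exacts [hy i, le_rfl]

theorem exists_injective_covering_jumps {k : ℕ} (τ : Fin k → ℝ) (hτ : ∀ i, 0 < τ i) {m : ℕ}
    (hk : k ≤ m) {t : ℝ} (ht : 0 < t) :
    ∃ s : Fin m → ℝ, (∀ j, s j ∈ Set.Icc 0 t) ∧ Function.Injective s ∧
      ∀ i, τ i ≤ t → ∃ j, s j = τ i := by
  classical
  have : Infinite (Set.Icc (0 : ℝ) t) := (Set.Icc_infinite ht).to_subtype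
  let A : Finset (Set.Icc (0 : ℝ) t) := Finset.univ.image fun i : {i // τ i ≤ t} =>
    ⟨τ i, (hτ i).le, i.2⟩
  have hA : A.card ≤ m := Finset.card_image_le.trans <| by
    rw [Finset.card_univ]
    exact (Fintype.card_subtype_le _).trans (by simpa using hk)
  obtain ⟨B, hAB, hB⟩ := Infinite.exists_superset_card_eq A m hA
  let e := B.equivFinOfCardEq hB
  refine ⟨fun j => (e.symm j).1.1, fun j => (e.symm j).1.2,
    Subtype.val_injective.comp (Subtype.val_injective.comp e.symm.injective), fun i hi => ?_⟩
  exact ⟨e ⟨⟨τ i, (hτ i).le, hi⟩, hAB (Finset.mem_image.2 ⟨⟨i, hi⟩, Finset.mem_univ _, rfl⟩)⟩,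
    by simp⟩

theorem J_stepFun {k : ℕ} (y τ : Fin k → ℝ) (hy : ∀ i, 0 ≤ y i) (hτ : ∀ i, 0 < τ i)
    {m : ℕ} (hk : k ≤ m) {t : ℝ} (ht : 0 ≤ t) :
    J m t (stepFun y τ) = stepFun y τ t := by
  rcases ht.eq_or_lt with rfl | ht
  · have h0 : stepFun y τ 0 = 0 := Finset.sum_eq_zero fun i _ => if_neg (hτ i).not_ge
    rw [h0]
    refine (iSup_congr fun s => ?_).trans Real.iSup_const_zero
    refine Finset.sum_eq_zero fun j _ => if_pos ?_
    exact le_antisymm (s.2.1 j).2 (s.2.1 j).1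
  · obtain ⟨s, hs, hsinj, hcov⟩ := exists_injective_covering_jumps τ hτ hk ht
    have hle (s : { s : Fin m → ℝ // (∀ i, s i ∈ Set.Icc 0 t) ∧ Function.Injective s }) :
        ∑ i, jumpAt (stepFun y τ) (s.val i) ≤ stepFun y τ t :=
      sum_jumpAt_stepFun_le y τ hy hτ s.2.1 s.2.2
    have : Nonempty { s : Fin m → ℝ // (∀ i, s i ∈ Set.Icc 0 t) ∧ Function.Injective s } :=
      ⟨⟨s, hs, hsinj⟩⟩
    refine le_antisymm (ciSup_le hle) ?_
    refine le_trans ?_ (le_ciSup ⟨_, Set.forall_mem_range.2 hle⟩ ⟨s, hs, hsinj⟩)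
    simp_rw [jumpAt_stepFun y τ hτ]
    rw [Finset.sum_comm]
    refine Finset.sum_le_sum fun i _ => ?_
    have hnonneg (j : Fin m) : 0 ≤ if τ i = s j then y i else 0 := by
      split_ifs
      exacts [hy i, le_rfl]
    split_ifs with h
    · obtain ⟨j, hj⟩ := hcov i h
      refine le_trans ?_ (Finset.single_le_sum (fun j _ => hnonneg j) (Finset.mem_univ j))
      simp [hj]
    · exact Finset.sum_nonneg fun j _ => hnonneg j

theorem iSup_Icc_neg_mul (c : ℝ) : ⨆ t : Set.Icc (0 : ℝ) 1, -(c * t.val) = max 0 (-c) := by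
  have hle (t : Set.Icc (0 : ℝ) 1) : -(c * t.val) ≤ max 0 (-c) := by
    obtain ⟨t, h0, h1⟩ := t
    rcases le_total 0 c with hc | hc
    · exact le_max_of_le_left (by simpa using mul_nonneg hc h0)
    · exact le_max_of_le_right (by simp only; nlinarith)
  have hbdd : BddAbove (Set.range fun t : Set.Icc (0 : ℝ) 1 => -(c * t.val)) :=
    ⟨_, Set.forall_mem_range.2 hle⟩
  refine le_antisymm (ciSup_le hle) (max_le ?_ ?_)
  · simpa using le_ciSup hbdd ⟨0, by simp⟩
  · simpa using le_ciSup hbdd ⟨1, by simp⟩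

/-- for a nondecreasing step function `f` vanishing at the origin with at
most `r` steps, `φ_EC(f) = c₋ = max(0,−c)`. -/
theorem phiEC_of_few_steps (c : ℝ) (r : ℕ) (hr : 1 ≤ r) (k : ℕ) (hk : k ≤ r)
    (y τ : Fin k → ℝ) (hy : ∀ i, 0 < y i) (hτ : ∀ i, τ i ∈ Set.Ioo (0:ℝ) 1)
    (hinj : Function.Injective τ) :
    phiEC c r (stepFun y τ) = max 0 (-c) := by
  have hτ0 : ∀ i, 0 < τ i := fun i => (hτ i).1
  rw [← iSup_Icc_neg_mul]
  refine iSup_congr fun t => ?_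
  rw [J_stepFun y τ (fun i => (hy i).le) hτ0 hk t.2.1,
    J_stepFun y τ (fun i => (hy i).le) hτ0 (hk.trans r.le_succ) t.2.1]
  ring
end

section
/- Let r ≥ 1 be an integer and let f = Σ_{i=1}^{r+1} y_i·1_{[t_i,1]} be a nondecreasing step function vanishing at the origin with exactly r+1 steps, where y_1 ≥ y_2 ≥ … ≥ y_{r+1} > 0 and t_1,…,t_{r+1} ∈ (0,1) are pairwise distinct. Then for every t ∈ [0,1], f(t) − J_r^t(f) equals y_{r+1} if t ≥ max{t_1,…,t_{r+1}} and equals 0 otherwise. -/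
open MeasureTheory Filter Set Polynomial

open Classical in
/-- The jumps of a step function at distinct points add up to the sizes of the steps hit. -/
theorem sum_jumpAt_stepFun {k m : ℕ} (y τ : Fin k → ℝ) (hτ : ∀ i, 0 < τ i)
    (s : Fin m → ℝ) (hs : Function.Injective s) :
    ∑ j, jumpAt (stepFun y τ) (s j) = ∑ i with τ i ∈ range s, y i := by
  simp_rw [jumpAt_stepFun y τ hτ]
  rw [Finset.sum_comm, Finset.sum_filter]
  refine Finset.sum_congr rfl fun i _ => ?_
  split_ifs with h
  · obtain ⟨j, hj⟩ := h
    rw [Finset.sum_eq_single j (fun b _ hb => if_neg fun h => hb (hs (h.symm.trans hj.symm)))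
      (by simp), if_pos hj.symm]
  · exact Finset.sum_eq_zero fun j _ => if_neg fun hj => h ⟨j, hj.symm⟩

/-- If every choice of at most `m` steps in `[0,t]` has total size at most that of one such
choice `T`, then `J m t` of the step function is the total size of `T`. -/
theorem J_stepFun_eq_sum {k m : ℕ} (hm : 0 < m) (y τ : Fin k → ℝ) (hy : ∀ i, 0 ≤ y i)
    (hτ : ∀ i, 0 < τ i) (hinj : Function.Injective τ) {t : ℝ} (ht : 0 < t) (T : Finset (Fin k))
    (hTt : ∀ i ∈ T, τ i ≤ t) (hTm : T.card ≤ m)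
    (hmax : ∀ S : Finset (Fin k), (∀ i ∈ S, τ i ≤ t) → S.card ≤ m →
      ∑ i ∈ S, y i ≤ ∑ i ∈ T, y i) :
    J m t (stepFun y τ) = ∑ i ∈ T, y i := by
  classical
  obtain ⟨A, hTA, hAt, hA⟩ := (Icc_infinite ht).exists_superset_ncard_eq
    (s := T.image τ) (k := m)
    (by
      intro x hx
      obtain ⟨i, hi, rfl⟩ := Finset.mem_image.1 (Finset.mem_coe.1 hx)
      exact ⟨(hτ i).le, hTt i hi⟩)
    (Finset.finite_toSet _)
    (by rw [ncard_coe_finset]; exact Finset.card_image_le.trans hTm)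
  have hub : ∀ s : { s : Fin m → ℝ // (∀ i, s i ∈ Set.Icc 0 t) ∧ Function.Injective s },
      ∑ j, jumpAt (stepFun y τ) (s.val j) ≤ ∑ i ∈ T, y i := by
    rintro ⟨s, hst, hs⟩
    rw [sum_jumpAt_stepFun y τ hτ s hs]
    apply hmax
    · intro i hi
      obtain ⟨j, hj⟩ := (Finset.mem_filter.1 hi).2
      exact hj ▸ (hst j).2
    · calc
        _ ≤ (Finset.univ.image s).card :=
          Finset.card_le_card_of_injOn τ (by intro i hi; simpa using hi) hinj.injOn
        _ ≤ m := Finset.card_image_le.trans (by simp)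
  obtain ⟨s, hs, hsA⟩ : ∃ s : Fin m → ℝ, Function.Injective s ∧ range s = A := by
    have := (finite_of_ncard_pos (hA ▸ hm)).fintype
    let e : Fin m ≃ A := (finCongr (by rw [← hA, Nat.card_coe_set_eq])).trans
      (Finite.equivFin A).symm
    exact ⟨fun j => e j, Subtype.val_injective.comp e.injective, by
      rw [show (fun j => (e j : ℝ)) = Subtype.val ∘ e from rfl, e.surjective.range_comp,
        Subtype.range_coe]⟩
  have hst : ∀ j, s j ∈ Set.Icc 0 t := fun j => hAt (hsA ▸ mem_range_self j)
  have : Nonempty { s : Fin m → ℝ // (∀ i, s i ∈ Set.Icc 0 t) ∧ Function.Injective s } :=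
    ⟨⟨s, hst, hs⟩⟩
  refine le_antisymm (ciSup_le hub)
    (le_ciSup_of_le ⟨_, forall_mem_range.2 hub⟩ ⟨s, hst, hs⟩ ?_)
  rw [sum_jumpAt_stepFun y τ hτ s hs]
  refine Finset.sum_le_sum_of_subset_of_nonneg (fun i hi => ?_) fun i _ _ => hy i
  rw [Finset.mem_filter, hsA]
  exact ⟨Finset.mem_univ i, hTA (Finset.mem_coe.2 (Finset.mem_image_of_mem τ hi))⟩

/-- for a nondecreasing step function with exactly `r+1` steps of sizes
`y 0 ≥ … ≥ y r > 0`, `f(t) − J_r^t(f)` equals `y_{r+1}` from `max{t_1,…,t_{r+1}}` on,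
and `0` before. -/
theorem stepFun_sub_jump_sum (r : ℕ) (hr : 1 ≤ r) (y τ : Fin (r+1) → ℝ)
    (hy : ∀ i, 0 < y i) (hmono : ∀ i j : Fin (r+1), i ≤ j → y j ≤ y i)
    (hτ : ∀ i, τ i ∈ Set.Ioo (0:ℝ) 1) (hinj : Function.Injective τ)
    (t : ℝ) (ht : t ∈ Set.Icc (0:ℝ) 1) :
    stepFun y τ t - J r t (stepFun y τ) =
      if (⨆ i, τ i) ≤ t then y (Fin.last r) else 0 := by
  have hpos : ∀ i, 0 < τ i := fun i => (hτ i).1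
  have hy0 : ∀ i, 0 ≤ y i := fun i => (hy i).le
  have hle : (⨆ i, τ i) ≤ t ↔ ∀ i, τ i ≤ t := ciSup_le_iff (finite_range τ).bddAbove
  rcases ht.1.eq_or_lt with rfl | ht0
  · have hJ : J r 0 (stepFun y τ) = 0 := by
      rw [J]
      convert Real.iSup_const_zero with s
      refine Finset.sum_eq_zero fun j _ => ?_
      rw [show s.val j = 0 by simpa using s.2.1 j, jumpAt, if_pos rfl]
    rw [hJ, if_neg fun h => (hpos 0).not_ge (hle.1 h 0), stepFun, sub_zero]
    exact Finset.sum_eq_zero fun i _ => if_neg (hpos i).not_ge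
  split_ifs with h
  · rw [hle] at h
    rw [J_stepFun_eq_sum hr y τ hy0 hpos hinj ht0 (Finset.univ.erase (Fin.last r))
      (fun i _ => h i) (by simp)]
    · simp [stepFun, h, Finset.sum_erase_eq_sub]
    · intro S _ hS
      obtain ⟨i, hi⟩ : ∃ i, i ∉ S := by
        by_contra! hall
        rw [Finset.eq_univ_of_forall hall] at hS
        simp at hS
      have h1 : ∑ j ∈ S, y j ≤ ∑ j ∈ Finset.univ.erase i, y j :=
        Finset.sum_le_sum_of_subset_of_nonneg
          (fun j hj => Finset.mem_erase.2 ⟨fun hji => hi (hji ▸ hj), Finset.mem_univ j⟩)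
          fun j _ _ => hy0 j
      have h2 := hmono i (Fin.last r) (Fin.le_last i)
      simp only [Finset.sum_erase_eq_sub (Finset.mem_univ _)] at h1 ⊢
      linarith
  · rw [hle] at h
    push Not at h
    obtain ⟨i, hi⟩ := h
    rw [J_stepFun_eq_sum hr y τ hy0 hpos hinj ht0 (Finset.univ.filter fun i => τ i ≤ t)
      (by simp)]
    · rw [stepFun, Finset.sum_filter, sub_self]
    · refine Nat.le_of_lt_succ ?_
      calc
        _ < (Finset.univ : Finset (Fin (r + 1))).card :=
          Finset.card_lt_card (Finset.filter_ssubset.2 ⟨i, Finset.mem_univ i, hi.not_ge⟩)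
        _ = r + 1 := by simp
    · intro S hS _
      exact Finset.sum_le_sum_of_subset_of_nonneg (fun j hj => by simpa using hS j hj)
        fun j _ _ => hy0 j
end

section
/- Let r ≥ 0 be an integer, let a > 0, c > 0 be real numbers, and let k be a real number with k > r+1. Then (1/r!)·∫_0^1 t^r·(a + c·t)^{−k} dt = a^{r+1−k} / (c^{r+1}·(k−r−1)_{r+1}) − Σ_{m=1}^{r+1} (a + c)^{m−k} / ((r+1−m)!·c^m·(k−m)_m), where (x)_m = x·(x+1)⋯(x+m−1) denotes the Pochhammer symbol (rising factorial). -/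
open MeasureTheory Filter Set Polynomial

theorem sum_Icc_one_eq_sum_range {M : Type*} [AddCommMonoid M] (f : ℕ → M) (n : ℕ) :
    ∑ m ∈ Finset.Icc 1 n, f m = ∑ i ∈ Finset.range n, f (i + 1) := by
  induction n with
  | zero => simp
  | succ n ih => rw [Finset.sum_Icc_succ_top (by omega), ih, Finset.sum_range_succ]

theorem hasDerivAt_affine_rpow {a c k x : ℝ} (hc : c ≠ 0) (hk : k ≠ 1) (hx : 0 < a + c * x) :
    HasDerivAt (fun t => -(a + c * t) ^ (1 - k) / (c * (k - 1))) ((a + c * x) ^ (-k)) x := by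
  have hk' : k - 1 ≠ 0 := sub_ne_zero.mpr hk
  have hd : HasDerivAt (fun t => a + c * t) c x := by
    simpa using ((hasDerivAt_id x).const_mul c).const_add a
  refine ((hd.rpow_const (p := 1 - k) (Or.inl hx.ne')).neg.div_const (c * (k - 1))).congr_deriv ?_
  rw [show 1 - k - 1 = -k by ring]
  field_simp
  ring

theorem intervalIntegrable_affine_rpow {a c : ℝ} (ha : 0 < a) (hc : 0 < c) (k : ℝ) :
    IntervalIntegrable (fun t => (a + c * t) ^ (-k)) volume 0 1 := by
  refine ContinuousOn.intervalIntegrable (ContinuousOn.rpow_const (by fun_prop) fun x hx => ?_)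
  rw [Set.uIcc_of_le zero_le_one] at hx
  exact Or.inl (add_pos_of_pos_of_nonneg ha (mul_nonneg hc.le hx.1)).ne'

theorem integral_affine_rpow {a c k : ℝ} (ha : 0 < a) (hc : 0 < c) (hk : k ≠ 1) :
    ∫ t in (0:ℝ)..1, (a + c * t) ^ (-k) =
      a ^ (1 - k) / (c * (k - 1)) - (a + c) ^ (1 - k) / (c * (k - 1)) := by
  rw [intervalIntegral.integral_eq_sub_of_hasDerivAt
    (fun x hx => hasDerivAt_affine_rpow hc.ne' hk ?_) (intervalIntegrable_affine_rpow ha hc k)]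
  · simp only [mul_one, mul_zero, add_zero]
    ring
  · rw [Set.uIcc_of_le zero_le_one] at hx
    exact add_pos_of_pos_of_nonneg ha (mul_nonneg hc.le hx.1)

theorem integral_pow_succ_mul_affine_rpow {a c k : ℝ} (r : ℕ) (ha : 0 < a) (hc : 0 < c)
    (hk : k ≠ 1) :
    ∫ t in (0:ℝ)..1, t ^ (r + 1) * (a + c * t) ^ (-k) =
      -(a + c) ^ (1 - k) / (c * (k - 1)) +
        ((r : ℝ) + 1) / (c * (k - 1)) * ∫ t in (0:ℝ)..1, t ^ r * (a + c * t) ^ (-(k - 1)) := by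
  rw [intervalIntegral.integral_mul_deriv_eq_deriv_mul
    (u := fun t => t ^ (r + 1)) (u' := fun t => ((r : ℝ) + 1) * t ^ r)
    (v := fun t => -(a + c * t) ^ (1 - k) / (c * (k - 1)))
    (fun x _ => by simpa using hasDerivAt_pow (r + 1) x)
    (fun x hx => hasDerivAt_affine_rpow hc.ne' hk ?_)
    (Continuous.intervalIntegrable (by fun_prop) _ _) (intervalIntegrable_affine_rpow ha hc k)]
  · rw [sub_eq_add_neg, ← intervalIntegral.integral_neg, ← intervalIntegral.integral_const_mul]
    congr 1
    · simp
    · refine intervalIntegral.integral_congr fun t _ => ?_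
      simp only [neg_sub]
      ring
  · rw [Set.uIcc_of_le zero_le_one] at hx
    exact add_pos_of_pos_of_nonneg ha (mul_nonneg hc.le hx.1)

/-- for `k > r+1`,
`(1/r!)·∫₀¹ tʳ (a+ct)^{−k} dt
  = a^{r+1−k}/(c^{r+1}·(k−r−1)_{r+1}) − Σ_{m=1}^{r+1} (a+c)^{m−k}/((r+1−m)!·cᵐ·(k−m)_m)`. -/
theorem integral_tr_rpow_eq_sum (r : ℕ) (a c k : ℝ) (ha : 0 < a) (hc : 0 < c)
    (hk : (r : ℝ) + 1 < k) :
    (1 / (r.factorial : ℝ)) * ∫ t in (0:ℝ)..1, t ^ r * (a + c * t) ^ (-k) =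
      a ^ ((r : ℝ) + 1 - k) /
        (c ^ (r + 1) * (ascPochhammer ℝ (r + 1)).eval (k - (r : ℝ) - 1)) -
      ∑ m ∈ Finset.Icc 1 (r + 1),
        (a + c) ^ ((m : ℝ) - k) /
          (((r + 1 - m).factorial : ℝ) * c ^ m * (ascPochhammer ℝ m).eval (k - (m : ℝ))) := by
  induction r generalizing k with
  | zero =>
    have hk' : k ≠ 1 := by
      rintro rfl
      simp at hk
    simpa using integral_affine_rpow ha hc hk'
  | succ r ih =>
    push_cast at hk
    have hr : (0:ℝ) ≤ r := r.cast_nonneg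
    have hk1 : k - 1 ≠ 0 := by linarith
    have hpoch (m : ℕ) (x : ℝ) (hx : x + m = k - 1) :
        (ascPochhammer ℝ (m + 1)).eval x = (ascPochhammer ℝ m).eval x * (k - 1) := by
      rw [ascPochhammer_succ_eval, hx]
    have ih' := ih (k - 1) (by linarith)
    rw [sum_Icc_one_eq_sum_range] at ih' ⊢
    rw [integral_pow_succ_mul_affine_rpow r ha hc (sub_ne_zero.mp hk1), Finset.sum_range_succ']
    have hfac : (((r + 1).factorial : ℕ) : ℝ) = ((r : ℝ) + 1) * r.factorial := by
      push_cast [Nat.factorial_succ]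
      ring
    have hf0 : (r.factorial : ℝ) ≠ 0 := by positivity
    have hr1 : (r : ℝ) + 1 ≠ 0 := by positivity
    have hsum : ∑ i ∈ Finset.range (r + 1),
        (a + c) ^ (((i + 1 + 1 : ℕ) : ℝ) - k) /
          (((r + 1 + 1 - (i + 1 + 1)).factorial : ℝ) * c ^ (i + 1 + 1) *
            (ascPochhammer ℝ (i + 1 + 1)).eval (k - ((i + 1 + 1 : ℕ) : ℝ))) =
        1 / (c * (k - 1)) * ∑ i ∈ Finset.range (r + 1),
          (a + c) ^ (((i + 1 : ℕ) : ℝ) - (k - 1)) /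
            (((r + 1 - (i + 1)).factorial : ℝ) * c ^ (i + 1) *
              (ascPochhammer ℝ (i + 1)).eval (k - 1 - ((i + 1 : ℕ) : ℝ))) := by
      rw [Finset.mul_sum]
      refine Finset.sum_congr rfl fun i _ => ?_
      rw [hpoch (i + 1) _ (by push_cast; ring), Nat.add_sub_add_right (r + 1) 1 (i + 1),
        show ((i + 1 + 1 : ℕ) : ℝ) - k = ((i + 1 : ℕ) : ℝ) - (k - 1) by push_cast; ring,
        show k - ((i + 1 + 1 : ℕ) : ℝ) = k - 1 - ((i + 1 : ℕ) : ℝ) by push_cast; ring,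
        div_mul_div_comm, one_mul, pow_succ c (i + 1)]
      congr 1
      ring
    rw [hsum, hpoch (r + 1) _ (by push_cast; ring), pow_succ c (r + 1),
      show ((r + 1 : ℕ) : ℝ) + 1 - k = (r : ℝ) + 1 - (k - 1) by push_cast; ring,
      show k - ((r + 1 : ℕ) : ℝ) - 1 = k - 1 - (r : ℝ) - 1 by push_cast; ring]
    have hmain : ∀ I A P S : ℝ, 1 / (r.factorial : ℝ) * I = A / (c ^ (r + 1) * P) - S →
        1 / ((r + 1).factorial : ℝ) *
          (-(a + c) ^ (1 - k) / (c * (k - 1)) + ((r : ℝ) + 1) / (c * (k - 1)) * I) =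
        A / (c ^ (r + 1) * c * (P * (k - 1))) - (1 / (c * (k - 1)) * S +
          (a + c) ^ (1 - k) / (((r + 1).factorial : ℝ) * c * (k - 1))) := by
      intro I A P S h
      have hA : A / (c ^ (r + 1) * c * (P * (k - 1))) =
          1 / (c * (k - 1)) * (A / (c ^ (r + 1) * P)) := by
        rw [div_mul_div_comm, one_mul]
        congr 1
        ring
      rw [hA, eq_add_of_sub_eq h.symm, hfac]
      field_simp
      ring
    simpa using hmain _ _ _ _ ih'
end

section
/- Let r ≥ 0 be an integer, let α > 1 be real, and let a > 0, c > 0 be real numbers. Then ∫_{[0,1]^{r+1}} [ ∫_{ { y ∈ ℝ^{r+1} : y_1 ≥ y_2 ≥ … ≥ y_{r+1} ≥ a + c·max{u_1,…,u_{r+1}} } } ∏_{i=1}^{r+1} α·y_i^{−α−1} dy ] du = (1/r!)·∫_0^1 t^r·(a + c·t)^{−(r+1)α} dt. -/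
open MeasureTheory Filter Set Polynomial

theorem antitone_snoc_iff {n : ℕ} {y : Fin n → ℝ} {t : ℝ} :
    Antitone (Fin.snoc y t : Fin (n + 1) → ℝ) ↔ Antitone y ∧ ∀ i, t ≤ y i := by
  constructor
  · intro h
    refine ⟨fun i j hij => ?_, fun i => ?_⟩
    · simpa using h (Fin.castSucc_le_castSucc_iff.2 hij)
    · simpa using h (Fin.le_last i.castSucc)
  · rintro ⟨hy, ht⟩ i j
    induction j using Fin.lastCases with
    | last =>
      induction i using Fin.lastCases with
      | last => simp
      | cast i => intro _; simpa using ht i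
    | cast j =>
      induction i using Fin.lastCases with
      | last => intro h; exact absurd h (not_le.2 (Fin.castSucc_lt_last j))
      | cast i => intro h; simpa using hy (Fin.castSucc_le_castSucc_iff.1 h)

/-- The antitone tuples of length `n` bounded below by `b`. -/
def antitoneAbove (n : ℕ) (b : ℝ) : Set (Fin n → ℝ) :=
  {y | Antitone y ∧ ∀ i, b ≤ y i}

theorem isClosed_antitoneAbove (n : ℕ) (b : ℝ) : IsClosed (antitoneAbove n b) := by
  simp only [antitoneAbove, Antitone, ofPred_and, ofPred_forall]
  refine IsClosed.inter ?_ ?_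
  · exact isClosed_iInter fun i => isClosed_iInter fun j => isClosed_iInter fun _ =>
      isClosed_le (continuous_apply j) (continuous_apply i)
  · exact isClosed_iInter fun i => isClosed_le continuous_const (continuous_apply i)

theorem snoc_mem_antitoneAbove_iff {n : ℕ} {b t : ℝ} {y : Fin n → ℝ} :
    (Fin.snoc y t : Fin (n + 1) → ℝ) ∈ antitoneAbove (n + 1) b ↔
      b ≤ t ∧ y ∈ antitoneAbove n t := by
  simp only [antitoneAbove, mem_ofPred_eq, antitone_snoc_iff, Fin.forall_fin_succ',
    Fin.snoc_castSucc, Fin.snoc_last]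
  exact ⟨fun h => ⟨h.2.2, h.1⟩, fun h => ⟨h.2, fun i => h.1.trans (h.2.2 i), h.1⟩⟩

theorem setLIntegral_antitoneAbove_succ (n : ℕ) (b : ℝ) {f : ℝ → ENNReal} (hf : Measurable f) :
    ∫⁻ y in antitoneAbove (n + 1) b, ∏ i, f (y i) =
      ∫⁻ t in Ici b, (∫⁻ y in antitoneAbove n t, ∏ i, f (y i)) * f t := by
  have hF (m : ℕ) : Measurable fun y : Fin m → ℝ => ∏ i, f (y i) := by fun_prop
  have hS (m : ℕ) (t : ℝ) := (isClosed_antitoneAbove m t).measurableSet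
  rw [← lintegral_indicator (hS _ _), ← lintegral_indicator measurableSet_Ici,
    ← ((volume_preserving_piFinSuccAbove (fun _ => ℝ) (Fin.last n)).symm _).lintegral_comp_emb
      (MeasurableEquiv.measurableEmbedding _), Measure.volume_eq_prod, lintegral_prod]
  · refine lintegral_congr fun t => ?_
    have key (y : Fin n → ℝ) :
        (MeasurableEquiv.piFinSuccAbove (fun _ => ℝ) (Fin.last n)).symm (t, y) =
          (Fin.snoc y t : Fin (n + 1) → ℝ) := Fin.insertNth_last' t y
    simp only [key]
    by_cases ht : b ≤ t
    · rw [indicator_of_mem (mem_Ici.2 ht), ← lintegral_mul_const _ (hF n),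
        ← lintegral_indicator (hS _ _)]
      refine lintegral_congr fun y => ?_
      by_cases hy : y ∈ antitoneAbove n t
      · rw [indicator_of_mem hy, indicator_of_mem (snoc_mem_antitoneAbove_iff.2 ⟨ht, hy⟩),
          Fin.prod_univ_castSucc]
        simp
      · rw [indicator_of_notMem hy,
          indicator_of_notMem fun h => hy (snoc_mem_antitoneAbove_iff.1 h).2]
    · rw [indicator_of_notMem (by simpa using ht), ← lintegral_zero (μ := (volume : Measure (Fin n → ℝ)))]
      refine lintegral_congr fun y => ?_
      rw [indicator_of_notMem fun h => ht (snoc_mem_antitoneAbove_iff.1 h).1]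
  · exact (((hF _).indicator (hS _ _)).comp (MeasurableEquiv.measurable _)).aemeasurable

theorem setLIntegral_Ici_rpow {p : ℝ} (hp : p < -1) {b : ℝ} (hb : 0 < b) :
    ∫⁻ t in Ici b, ENNReal.ofReal (t ^ p) = ENNReal.ofReal (-b ^ (p + 1) / (p + 1)) := by
  rw [setLIntegral_congr Ioi_ae_eq_Ici.symm, ← integral_Ioi_rpow_of_lt hp hb,
    ofReal_integral_eq_lintegral_ofReal (integrableOn_Ioi_rpow_of_lt hp hb)]
  exact (ae_restrict_mem measurableSet_Ioi).mono fun t ht =>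
    Real.rpow_nonneg (hb.le.trans (le_of_lt ht)) _

theorem setLIntegral_antitoneAbove_pareto {α : ℝ} (hα : 0 < α) (n : ℕ) {b : ℝ} (hb : 0 < b) :
    ∫⁻ y in antitoneAbove n b, ∏ i, ENNReal.ofReal (α * y i ^ (-α - 1)) =
      ENNReal.ofReal (b ^ (-(n * α)) / n.factorial) := by
  induction n generalizing b with
  | zero =>
    have : antitoneAbove 0 b = univ := by
      ext y; simp [antitoneAbove, Antitone]
    simp [this, volume_pi]
  | succ n ih =>
    rw [setLIntegral_antitoneAbove_succ n b (f := fun t => ENNReal.ofReal (α * t ^ (-α - 1)))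
      (by fun_prop)]
    have hn : (0 : ℝ) < n.factorial := by positivity
    have hna : 0 ≤ (n : ℝ) * α := by positivity
    have h1 : ∀ t ∈ Ici b, (∫⁻ y in antitoneAbove n t,
        ∏ i, ENNReal.ofReal (α * y i ^ (-α - 1))) * ENNReal.ofReal (α * t ^ (-α - 1)) =
        ENNReal.ofReal (α / n.factorial) * ENNReal.ofReal (t ^ (-((n + 1) * α) - 1)) := by
      intro t ht
      have ht0 : 0 < t := hb.trans_le ht
      rw [ih ht0, ← ENNReal.ofReal_mul (by positivity), ← ENNReal.ofReal_mul (by positivity),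
        show -((n + 1) * α) - 1 = -(n * α) + (-α - 1) by ring, Real.rpow_add ht0]
      congr 1
      ring
    rw [setLIntegral_congr_fun measurableSet_Ici h1,
      lintegral_const_mul _ (by fun_prop), setLIntegral_Ici_rpow (by linarith) hb,
      ← ENNReal.ofReal_mul (by positivity), Nat.factorial_succ]
    congr 1
    push_cast
    rw [sub_add_cancel]
    field_simp

theorem setIntegral_antitoneAbove_pareto {α : ℝ} (hα : 0 < α) (n : ℕ) {b : ℝ} (hb : 0 < b) :
    ∫ y in antitoneAbove n b, ∏ i, α * y i ^ (-α - 1) =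
      b ^ (-(n * α)) / n.factorial := by
  have hS := (isClosed_antitoneAbove n b).measurableSet
  have hnn : ∀ y ∈ antitoneAbove n b, ∀ i, 0 ≤ α * y i ^ (-α - 1) := fun y hy i =>
    mul_nonneg hα.le (Real.rpow_nonneg (hb.le.trans (hy.2 i)) _)
  rw [integral_eq_lintegral_of_nonneg_ae
    ((ae_restrict_mem hS).mono fun y hy => Finset.prod_nonneg fun i _ => hnn y hy i)
    (by fun_prop : Measurable fun y : Fin n → ℝ => ∏ i, α * y i ^ (-α - 1)).aestronglyMeasurable,
    setLIntegral_congr_fun hS fun y hy => ENNReal.ofReal_prod_of_nonneg fun i _ => hnn y hy i,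
    setLIntegral_antitoneAbove_pareto hα n hb, ENNReal.toReal_ofReal (by positivity)]

/-- The maximum of `r + 1` independent uniform variables on `[0, 1]` has density
`(r + 1) * t ^ r`. -/
theorem map_iSup_volume_restrict_cube (r : ℕ) :
    (volume.restrict {u : Fin (r + 1) → ℝ | ∀ i, u i ∈ Icc (0 : ℝ) 1}).map (fun u => ⨆ i, u i) =
      (volume.restrict (Ioc (0 : ℝ) 1)).withDensity
        fun t => ENNReal.ofReal ((r + 1) * t ^ r) := by
  have hcube : {u : Fin (r + 1) → ℝ | ∀ i, u i ∈ Icc (0 : ℝ) 1} = Icc 0 1 := by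
    ext u; simp [Pi.le_def, forall_and]
  have hsup : Measurable fun u : Fin (r + 1) → ℝ => ⨆ i, u i :=
    Measurable.iSup fun i => measurable_pi_apply i
  have : IsFiniteMeasure (volume.restrict {u : Fin (r + 1) → ℝ | ∀ i, u i ∈ Icc (0 : ℝ) 1}) := by
    exact hcube ▸ isFiniteMeasure_restrict.2 isCompact_Icc.measure_lt_top.ne
  refine Measure.ext_of_Iic _ _ fun s => ?_
  rw [Measure.map_apply hsup measurableSet_Iic, Measure.restrict_apply (hsup measurableSet_Iic),
    withDensity_apply _ measurableSet_Iic, Measure.restrict_restrict measurableSet_Iic]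
  have hset : (fun u : Fin (r + 1) → ℝ => ⨆ i, u i) ⁻¹' Iic s ∩
      {u | ∀ i, u i ∈ Icc (0 : ℝ) 1} = Icc (fun _ => 0) (fun _ => min 1 s) := by
    ext u
    simp only [mem_inter_iff, mem_preimage, mem_Iic, ciSup_le_iff (finite_range u).bddAbove,
      mem_ofPred_eq, mem_Icc, Pi.le_def, le_min_iff, forall_and]
    tauto
  have hIoc : Iic s ∩ Ioc (0 : ℝ) 1 = Ioc 0 (min 1 s) := by
    ext t; simp; tauto
  rw [hset, hIoc, Real.volume_Icc_pi]
  simp only [sub_zero, Finset.prod_const, Finset.card_univ, Fintype.card_fin]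
  rcases le_total (min 1 s) 0 with hs | hs
  · simp [Ioc_eq_empty (not_lt.2 hs), ENNReal.ofReal_of_nonpos hs]
  · rw [← ENNReal.ofReal_pow hs, ← ofReal_integral_eq_lintegral_ofReal,
      ← intervalIntegral.integral_of_le hs, intervalIntegral.integral_const_mul, integral_pow]
    · congr 1
      field_simp
      simp
    · exact (by fun_prop : Continuous fun t : ℝ => (r + 1 : ℝ) * t ^ r).integrableOn_Ioc
    · refine (ae_restrict_mem measurableSet_Ioc).mono fun t ht => ?_
      have := ht.1.le
      positivity

theorem setIntegral_cube_comp_iSup (r : ℕ) {F : ℝ → ℝ} (hF : Measurable F) :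
    ∫ u in {u : Fin (r + 1) → ℝ | ∀ i, u i ∈ Icc (0 : ℝ) 1}, F (⨆ i, u i) =
      ∫ t in (0 : ℝ)..1, (r + 1) * t ^ r * F t := by
  have hsup : Measurable fun u : Fin (r + 1) → ℝ => ⨆ i, u i :=
    Measurable.iSup fun i => measurable_pi_apply i
  rw [← integral_map hsup.aemeasurable hF.aestronglyMeasurable,
    map_iSup_volume_restrict_cube, integral_withDensity_eq_integral_toReal_smul (by fun_prop)
      (by simp), intervalIntegral.integral_of_le zero_le_one]
  refine setIntegral_congr_fun measurableSet_Ioc fun t ht => ?_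
  have := ht.1.le
  simp only [smul_eq_mul]
  rw [ENNReal.toReal_ofReal (by positivity)]

/-- integrating the density `∏ i, α·y_i^{−α−1}` over
`{y : y_1 ≥ … ≥ y_{r+1} ≥ a + c·max{u_1,…,u_{r+1}}}` and then over `u ∈ [0,1]^{r+1}`
gives `(1/r!)·∫₀¹ tʳ (a + ct)^{−(r+1)α} dt`. -/
theorem iterated_integral_eq (r : ℕ) (α : ℝ) (hα : 1 < α)
    (a c : ℝ) (ha : 0 < a) (hc : 0 < c) :
    (∫ u in { u : Fin (r+1) → ℝ | ∀ i, u i ∈ Set.Icc (0:ℝ) 1 },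
      (∫ y in { y : Fin (r+1) → ℝ | (∀ i j : Fin (r+1), i ≤ j → y j ≤ y i) ∧
          a + c * (⨆ i, u i) ≤ y (Fin.last r) },
        ∏ i, α * y i ^ (-α - 1))) =
    (1 / (r.factorial : ℝ)) *
      ∫ t in (0:ℝ)..1, t ^ r * (a + c * t) ^ (-(((r : ℝ) + 1) * α)) := by
  have hα0 : 0 < α := zero_lt_one.trans hα
  have hset (b : ℝ) : {y : Fin (r + 1) → ℝ | (∀ i j : Fin (r + 1), i ≤ j → y j ≤ y i) ∧
      b ≤ y (Fin.last r)} = antitoneAbove (r + 1) b := by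
    ext y
    exact ⟨fun h => ⟨fun i j => h.1 i j, fun i => h.2.trans (h.1 _ _ (Fin.le_last i))⟩,
      fun h => ⟨fun i j => @h.1 i j, h.2 _⟩⟩
  have hcube : MeasurableSet {u : Fin (r + 1) → ℝ | ∀ i, u i ∈ Icc (0 : ℝ) 1} := by
    measurability
  have hinner : ∀ u ∈ {u : Fin (r + 1) → ℝ | ∀ i, u i ∈ Icc (0 : ℝ) 1},
      (∫ y in {y : Fin (r + 1) → ℝ | (∀ i j : Fin (r + 1), i ≤ j → y j ≤ y i) ∧
          a + c * (⨆ i, u i) ≤ y (Fin.last r)}, ∏ i, α * y i ^ (-α - 1)) =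
        (a + c * ⨆ i, u i) ^ (-(((r : ℝ) + 1) * α)) / (r + 1).factorial := by
    intro u hu
    have hsup : 0 ≤ ⨆ i, u i := Real.iSup_nonneg fun i => (hu i).1
    rw [hset, setIntegral_antitoneAbove_pareto hα0 (r + 1) (by positivity)]
    push_cast
    rfl
  rw [setIntegral_congr_fun hcube hinner, setIntegral_cube_comp_iSup r
    (F := fun t => (a + c * t) ^ (-(((r : ℝ) + 1) * α)) / (r + 1).factorial) (by fun_prop),
    ← intervalIntegral.integral_const_mul]
  congr 1
  ext t
  rw [Nat.factorial_succ]
  push_cast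
  field_simp
end
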